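/- Let J be an almost complex structure on a neighborhood of a point p ∈ ℂⁿ and let Γ = {ρ = 0} be a smooth real hypersurface through p with dρ_p ≠ 0, strongly pseudoconvex at p with respect to J, i.e. (for a suitably signed defining function ρ) the Levi form v ↦ −d(dρ∘J)_p(v, J_p v) is positive definite on D_p = {v : dρ_p(v) = 0 and dρ_p(J_p v) = 0}. Then there exist open neighborhoods U of p and V of 0 and a smooth diffeomorphism Φ : U → V with Φ(p) = 0 such that in the new coordinates (J, Γ) is in standard form: the pushforward structure J̃_w := dΦ ∘ J_{Φ^{−1}(w)} ∘ dΦ^{−1} satisfies J̃₀ = J_st, its first-order coefficients satisfy L̃^n_{ᾱβ} = 0 and L̃^n_{ᾱβ̄} = −L̃^n_{β̄ᾱ} for all 1 ≤ α, β ≤ n−1, and Φ(Γ ∩ U) admits near 0 a smooth defining function ρ̃ with ρ̃(w) = 2 Re wⁿ − Σ_{α=1}^{n−1}|w^α|² + O(|w|³). -/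

import Mathlib

open Complex ComplexConjugate Finset Asymptotics

noncomputable section

/-- Standard complex structure of `ℂⁿ`: multiplication by `i`. -/
def Jstd (n : ℕ) : (Fin n → ℂ) →L[ℝ] (Fin n → ℂ) :=
  Complex.I • ContinuousLinearMap.id ℝ (Fin n → ℂ)

/-- The 1-form `θ := dρ ∘ J`. -/
def theta (n : ℕ) (ρ : (Fin n → ℂ) → ℝ)
    (J : (Fin n → ℂ) → ((Fin n → ℂ) →L[ℝ] (Fin n → ℂ)))
    (z : Fin n → ℂ) : (Fin n → ℂ) →L[ℝ] ℝ :=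
  (fderiv ℝ ρ z).comp (J z)

/-- Exterior derivative of the 1-form `θ`. -/
def dtheta (n : ℕ) (ρ : (Fin n → ℂ) → ℝ)
    (J : (Fin n → ℂ) → ((Fin n → ℂ) →L[ℝ] (Fin n → ℂ)))
    (z u w : Fin n → ℂ) : ℝ :=
  fderiv ℝ (theta n ρ J) z u w - fderiv ℝ (theta n ρ J) z w u

/-- A `J`-invariant positive definite form admits a `J`-complex orthonormal frame whose last vector
is a prescribed unit vector. -/
theorem exists_linearEquiv_of_invariant_form {E : Type*} [AddCommGroup E] [Module ℝ E]
    [FiniteDimensional ℝ E] (n : ℕ) (hdim : Module.finrank ℝ E = 2 * (n + 1))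
    (J : E →ₗ[ℝ] E) (hJ : ∀ v, J (J v) = -v) (g : E →ₗ[ℝ] E →ₗ[ℝ] ℝ)
    (hsymm : ∀ u v, g u v = g v u) (hinv : ∀ u v, g (J u) (J v) = g u v)
    (hpos : ∀ v, v ≠ 0 → 0 < g v v) (e : E) (he : g e e = 1) :
    ∃ T : E ≃ₗ[ℝ] (Fin (n + 1) → ℂ), (∀ v, T (J v) = I • T v) ∧
      (∀ v, g v v = ∑ i, normSq (T v i)) ∧
      ∀ v, T v (Fin.last n) = g e v + g (J e) v * I := by
  have hJl (u v : E) : g (J u) v = -g u (J v) := by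
    have := hinv u (J v)
    rw [hJ, map_neg] at this
    linarith
  have hJs (v : E) : g (J v) v = 0 := by
    have := hJl v v
    rw [hsymm v (J v)] at this
    linarith
  let modC : Module ℂ E :=
    { smul := fun c v => c.re • v + c.im • J v
      one_smul := fun v => by
        change (1 : ℂ).re • v + (1 : ℂ).im • J v = v
        simp
      mul_smul := fun a b v => by
        change (a * b).re • v + (a * b).im • J v =
          a.re • (b.re • v + b.im • J v) + a.im • J (b.re • v + b.im • J v)
        simp only [mul_re, mul_im, map_add, map_smul, hJ]
        module
      smul_zero := fun a => by
        change a.re • (0 : E) + a.im • J 0 = 0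
        simp
      smul_add := fun a u v => by
        change a.re • (u + v) + a.im • J (u + v) =
          (a.re • u + a.im • J u) + (a.re • v + a.im • J v)
        simp only [map_add]
        module
      add_smul := fun a b v => by
        change (a + b).re • v + (a + b).im • J v =
          (a.re • v + a.im • J v) + (b.re • v + b.im • J v)
        simp only [add_re, add_im]
        module
      zero_smul := fun v => by
        change (0 : ℂ).re • v + (0 : ℂ).im • J v = 0
        simp }
  have smul_def (c : ℂ) (v : E) : c • v = c.re • v + c.im • J v := rfl
  have tower : IsScalarTower ℝ ℂ E := ⟨fun r c v => by
    simp only [smul_def, real_smul, mul_re, mul_im, ofReal_re, ofReal_im]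
    module⟩
  have hdimC : Module.finrank ℂ E = Fintype.card (Fin (n + 1)) := by
    have := Module.finrank_mul_finrank ℝ ℂ E
    rw [finrank_real_complex, hdim] at this
    simp only [Fintype.card_fin]
    omega
  let core : InnerProductSpace.Core ℂ E :=
    { inner := fun u v => (g u v : ℂ) + (g (J u) v : ℂ) * I
      conj_inner_symm := fun u v => by
        apply Complex.ext
        · simp [hsymm u v]
        · simp [hJl u v, hsymm u (J v)]
      re_inner_nonneg := fun v => by
        by_cases hv : v = 0
        · simp [hv]
        · simpa using (hpos v hv).le
      add_left := fun u v w => by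
        simp only [map_add, LinearMap.add_apply]
        push_cast
        ring
      smul_left := fun u v c => by
        apply Complex.ext
        · simp [smul_def, hJ]
        · simp [smul_def, hJ]
      definite := fun v hv => by
        by_contra h
        have h1 := congrArg Complex.re hv
        have h2 := hpos v h
        simp at h1
        linarith }
  let nacg : NormedAddCommGroup E := core.toNormedAddCommGroup
  let ips : InnerProductSpace ℂ E := InnerProductSpace.ofCore core.toCore
  have inner_def (u v : E) : inner ℂ u v = (g u v : ℂ) + (g (J u) v : ℂ) * I := rfl
  have : FiniteDimensional ℂ E := FiniteDimensional.right ℝ ℂ E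
  have hon : Orthonormal ℂ (({Fin.last n} : Set (Fin (n + 1))).domRestrict fun _ => e) := by
    constructor
    · intro i
      have h1 : ‖e‖ ^ 2 = 1 := by
        rw [InnerProductSpace.norm_sq_eq_re_inner (𝕜 := ℂ), inner_def]
        simp [he]
      have h2 : (0 : ℝ) ≤ ‖e‖ := norm_nonneg e
      change ‖e‖ = 1
      nlinarith
    · intro i j hij
      exact absurd (Subsingleton.elim i j) hij
  obtain ⟨b, hb⟩ := hon.exists_orthonormalBasis_extension_of_card_eq hdimC
  let R : E ≃ₗ[ℝ] (Fin (n + 1) → ℂ) :=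
    (b.repr.toLinearEquiv.restrictScalars ℝ).trans
      ((WithLp.linearEquiv 2 ℂ (Fin (n + 1) → ℂ)).restrictScalars ℝ)
  have hR (v : E) (i : Fin (n + 1)) : R v i = inner ℂ (b i) v := b.repr_apply_apply v i
  have hlast (v : E) : inner ℂ (b (Fin.last n)) v = inner ℂ e v := by
    rw [hb (Fin.last n) rfl]
  refine ⟨R, fun v => ?_, fun v => ?_, fun v => ?_⟩
  · have : J v = (I : ℂ) • v := by simp [smul_def]
    rw [this]
    ext i
    rw [Pi.smul_apply, hR, hR, inner_smul_right, smul_eq_mul]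
  · have h1 : ‖v‖ ^ 2 = g v v := by
      rw [InnerProductSpace.norm_sq_eq_re_inner (𝕜 := ℂ), inner_def]
      simp
    rw [← h1, ← b.sum_sq_norm_inner_right v]
    simp only [hR, Complex.normSq_eq_norm_sq]
  · rw [hR, hlast, inner_def]

/-- A conjugate-linear first-order term of an almost complex structure can be made antisymmetric
and conjugate linear in both arguments by a quadratic change of coordinates. -/
theorem exists_symm_bilinear_antisymmetrize {m : ℕ}
    (L : (Fin m → ℂ) →L[ℝ] (Fin m → ℂ) →L[ℝ] (Fin m → ℂ))
    (hL : ∀ y x, L y (I • x) = -(I • L y x)) :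
    ∃ S : (Fin m → ℂ) →L[ℝ] (Fin m → ℂ) →L[ℝ] (Fin m → ℂ),
      (∀ y x, S y x = S x y) ∧
      (∀ y x, S (I • y) (I • x) - I • S (I • y) x + L (I • y) x =
        -(I • (S y (I • x) - I • S y x + L y x))) ∧
      (∀ y x, S y (I • x) - I • S y x + L y x = -(S x (I • y) - I • S x y + L x y)) ∧
      ∀ y, S y y + S (I • y) (I • y) = L y (I • y) - L (I • y) y := by
  have hf : IsBilinearMap ℝ fun y x : Fin m → ℂ =>
      (-(I / 2)) • ((3 / 4 : ℂ) • (L y x + L x y) -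
        (I / 4) • (L (I • y) x + L (I • x) y)) := by
    have hI (r : ℝ) (y : Fin m → ℂ) : I • r • y = r • I • y := smul_comm _ _ _
    constructor <;> intros <;>
      simp only [smul_add, map_add, add_apply, hI, map_smul,
        smul_apply] <;> ext i <;> simp <;> ring
  have hII (y : Fin m → ℂ) : I • I • y = -y := by simp [smul_smul]
  refine ⟨hf.toContinuousBilinearMap, fun y x => ?_, fun y x => ?_, fun y x => ?_, fun y => ?_⟩ <;>
    simp only [IsBilinearMap.toContinuousBilinearMap_apply, hII, hL, map_neg,
      neg_apply] <;>
    ext i <;> apply Complex.ext <;> simp <;> ring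

/-- A real quadratic form that agrees with the squared norm on the complex hyperplane
`{yₙ = 0}` after averaging over `i`, is, up to the squared norm of the first coordinates, a multiple
of `Re yₙ` and the real part of a holomorphic quadratic form. -/
theorem exists_holomorphic_quadratic {n : ℕ}
    (A : (Fin (n + 1) → ℂ) →L[ℝ] (Fin (n + 1) → ℂ) →L[ℝ] ℝ) (hA : ∀ y x, A y x = A x y)
    (hlevi : ∀ y : Fin (n + 1) → ℂ, y (Fin.last n) = 0 →
      A y y + A (I • y) (I • y) = 2 * ∑ α : Fin n, normSq (y α.castSucc)) :
    ∃ (μ : (Fin (n + 1) → ℂ) →L[ℝ] ℝ) (c : (Fin (n + 1) → ℂ) →L[ℝ] (Fin (n + 1) → ℂ) →L[ℝ] ℂ),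
      (∀ y x, c y x = c x y) ∧ (∀ y x, c y (I • x) = I * c y x) ∧
      ∀ y, (c y y).re = ∑ α : Fin n, normSq (y α.castSucc) - A y y +
        2 * μ y * (y (Fin.last n)).re := by
  have hII (y : Fin (n + 1) → ℂ) : I • I • y = -y := by simp [smul_smul]
  have hI (r : ℝ) (y : Fin (n + 1) → ℂ) : I • r • y = r • I • y := smul_comm _ _ _
  let e : Fin (n + 1) → ℂ := Pi.single (Fin.last n) 1
  let G (y x : Fin (n + 1) → ℂ) : ℝ := A y x + A (I • y) (I • x) -
    2 * ∑ α : Fin n, (y α.castSucc * conj (x α.castSucc)).re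
  have hGa (y y' x) : G (y + y') x = G y x + G y' x := by
    simp only [G, smul_add, map_add, add_apply, Pi.add_apply, add_mul, add_re,
      Finset.sum_add_distrib]
    ring
  have hGs (r : ℝ) (y x) : G (r • y) x = r * G y x := by
    simp only [G, hI, map_smul, smul_apply, Pi.smul_apply, smul_mul_assoc,
      smul_re, smul_eq_mul, ← Finset.mul_sum]
    ring
  have hGc (y x) : G y x = G x y := by
    simp only [G, hA x, hA (I • x)]
    congr 2
    refine Finset.sum_congr rfl fun α _ => ?_
    simp
    ring
  have hGI (y x) : G (I • y) (I • x) = G y x := by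
    simp only [G, hII, map_neg, neg_apply, neg_neg]
    rw [add_comm (A (I • y) (I • x))]
    congr 2
    refine Finset.sum_congr rfl fun α _ => ?_
    simp
  have hG0 (y : Fin (n + 1) → ℂ) (hy : y (Fin.last n) = 0) : G y y = 0 := by
    simp only [G, mul_conj, ofReal_re]
    rw [hlevi y hy, sub_self]
  have hGe : G (I • e) e = 0 := by
    have h1 := hGI (I • e) e
    rw [hII, hGc (I • e) e] at h1
    have h2 := hGs (-1) e (I • e)
    rw [neg_one_smul] at h2
    rw [hGc]
    linarith
  let μ₀ : (Fin (n + 1) → ℂ) →ₗ[ℝ] ℝ :=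
    { toFun := fun y => G y e - G e e / 2 * (y (Fin.last n)).re
      map_add' := fun y y' => by simp [hGa]; ring
      map_smul' := fun r y => by simp [hGs]; ring }
  let μ : (Fin (n + 1) → ℂ) →L[ℝ] ℝ := LinearMap.toContinuousLinearMap μ₀
  have hμ (y) : μ y = G y e - G e e / 2 * (y (Fin.last n)).re := rfl
  -- decompose `y = y' + a e + b (i e)`
  have hμG (y : Fin (n + 1) → ℂ) :
      2 * μ y * (y (Fin.last n)).re + 2 * μ (I • y) * ((I • y) (Fin.last n)).re = G y y := by
    obtain ⟨z, a, b, hz, rfl⟩ : ∃ (z : Fin (n + 1) → ℂ) (a b : ℝ), z (Fin.last n) = 0 ∧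
        y = z + (a • e + b • I • e) := by
      refine ⟨y - ((y (Fin.last n)).re • e + (y (Fin.last n)).im • I • e),
        (y (Fin.last n)).re, (y (Fin.last n)).im, ?_, by abel⟩
      apply Complex.ext <;> simp [e]
    have hGe' : G e (I • e) = 0 := by rw [hGc, hGe]
    have hzI : G (I • z) e = - G z (I • e) := by
      have h1 := hGI z (I • e)
      have h2 := hGs (-1) e (I • z)
      rw [neg_one_smul] at h2
      rw [hII, hGc, h2] at h1
      rw [hGc]
      linarith
    have hGa' (x y y') : G x (y + y') = G x y + G x y' := by
      rw [hGc, hGa, hGc y, hGc y']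
    have hGs' (r : ℝ) (x y) : G x (r • y) = r * G x y := by
      rw [hGc, hGs, hGc y]
    have hGn (x y) : G (-x) y = - G x y := by
      rw [← neg_one_smul ℝ x, hGs]
      ring
    have r1 : ((z + (a • e + b • I • e)) (Fin.last n)).re = a := by simp [hz, e]
    have r2 : ((I • (z + (a • e + b • I • e))) (Fin.last n)).re = -b := by simp [hz, e]
    have hee : G (I • e) (I • e) = G e e := hGI e e
    have hez : G e z = G z e := hGc _ _
    have hiez : G (I • e) z = G z (I • e) := hGc _ _
    rw [hμ, hμ, r1, r2]
    simp only [smul_add, hI, hII, smul_neg, hGa, hGa', hGs, hGs', hGn, hGe, hGe', hG0 z hz, hzI,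
      hee, hez, hiez]
    ring
  let Q (y x : Fin (n + 1) → ℂ) : ℝ :=
    ∑ α : Fin n, (y α.castSucc * conj (x α.castSucc)).re - A y x +
      (μ y * (x (Fin.last n)).re + μ x * (y (Fin.last n)).re)
  have hQa (y y' x) : Q (y + y') x = Q y x + Q y' x := by
    simp only [Q, map_add, add_apply, Pi.add_apply, add_mul, add_re,
      Finset.sum_add_distrib]
    ring
  have hQs (r : ℝ) (y x) : Q (r • y) x = r * Q y x := by
    simp only [Q, map_smul, smul_apply, Pi.smul_apply, smul_mul_assoc,
      smul_re, smul_eq_mul, ← Finset.mul_sum]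
    ring
  have hQc (y x) : Q y x = Q x y := by
    simp only [Q, hA x]
    rw [add_comm (μ y * _)]
    congr 2
    refine Finset.sum_congr rfl fun α _ => ?_
    simp
    ring
  have hQa' (x y y') : Q x (y + y') = Q x y + Q x y' := by
    rw [hQc, hQa, hQc y, hQc y']
  have hQs' (r : ℝ) (x y) : Q x (r • y) = r * Q x y := by
    rw [hQc, hQs, hQc y]
  have hQn (x y) : Q (-x) y = - Q x y := by
    rw [← neg_one_smul ℝ x, hQs]
    ring
  have hQdiag (y) : Q y y + Q (I • y) (I • y) = 0 := by
    have h := hμG y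
    have hs : ∑ α : Fin n, ((I • y) α.castSucc * conj ((I • y) α.castSucc)).re =
        ∑ α : Fin n, (y α.castSucc * conj (y α.castSucc)).re := by
      refine Finset.sum_congr rfl fun α _ => ?_
      simp
    simp only [G] at h
    simp only [Q, hs]
    linarith
  have hQI (y x) : Q (I • y) (I • x) = - Q y x := by
    have h := hQdiag (y + x)
    simp only [smul_add, hQa, hQa'] at h
    have h1 := hQdiag y
    have h2 := hQdiag x
    have h3 := hQc y x
    have h4 := hQc (I • y) (I • x)
    linarith
  have hQI' (y x) : Q (I • y) x = Q y (I • x) := by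
    have h := hQI y (I • x)
    rw [hII, hQc, hQn, hQc x] at h
    linarith
  have hc : IsBilinearMap ℝ fun y x : Fin (n + 1) → ℂ => (Q y x : ℂ) - Q (I • y) x * I := by
    constructor <;> intros <;> simp only [smul_add, hI, hQa, hQa', hQs, hQs'] <;>
      simp <;> ring
  refine ⟨μ, hc.toContinuousBilinearMap, fun y x => ?_, fun y x => ?_, fun y => ?_⟩
  · simp only [IsBilinearMap.toContinuousBilinearMap_apply]
    rw [hQc y x, hQI' y x, hQc y]
  · simp only [IsBilinearMap.toContinuousBilinearMap_apply]
    rw [hQI, ← hQI']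
    apply Complex.ext <;> simp
  · simp only [IsBilinearMap.toContinuousBilinearMap_apply]
    simp only [Q, mul_conj, sub_re, ofReal_re, re_ofReal_mul, I_re]
    ring

/-- Integrated form of a bound on the derivative near a point. -/
theorem isBigO_sub_of_fderiv_isBigO {E F : Type*} [NormedAddCommGroup E] [NormedSpace ℝ E]
    [NormedAddCommGroup F] [NormedSpace ℝ F] {f : E → F} {p : E} {k : ℕ}
    (hd : ∀ᶠ z in nhds p, DifferentiableAt ℝ f z)
    (h : fderiv ℝ f =O[nhds p] fun z => ‖z - p‖ ^ k) :
    (fun z => f z - f p) =O[nhds p] fun z => ‖z - p‖ ^ (k + 1) := by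
  obtain ⟨C, hC⟩ := h.bound
  obtain ⟨ε, hε, hball⟩ := Metric.eventually_nhds_iff_ball.1 (hd.and hC)
  refine IsBigO.of_bound |C| ?_
  filter_upwards [Metric.ball_mem_nhds p hε] with z hz
  have hsub : ∀ x ∈ Metric.closedBall p ‖z - p‖, x ∈ Metric.ball p ε := fun x hx => by
    rw [Metric.mem_closedBall] at hx
    rw [Metric.mem_ball, dist_eq_norm] at hz
    exact Metric.mem_ball.2 (hx.trans_lt hz)
  have hb : ∀ x ∈ Metric.closedBall p ‖z - p‖, ‖fderiv ℝ f x‖ ≤ |C| * ‖z - p‖ ^ k := by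
    intro x hx
    have h1 := (hball x (hsub x hx)).2
    rw [norm_pow, norm_norm] at h1
    rw [Metric.mem_closedBall, dist_eq_norm] at hx
    refine h1.trans ?_
    gcongr
    exact le_abs_self C
  have := (convex_closedBall p ‖z - p‖).norm_image_sub_le_of_norm_fderiv_le
    (fun x hx => (hball x (hsub x hx)).1) hb (Metric.mem_closedBall_self (norm_nonneg _))
    (show z ∈ Metric.closedBall p ‖z - p‖ by rw [Metric.mem_closedBall, dist_eq_norm])
  rw [norm_pow, norm_norm, pow_succ, ← mul_assoc]
  exact this

/-- Second-order Taylor expansion with third-order remainder. -/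
theorem taylor_two_isBigO {E : Type*} [NormedAddCommGroup E] [NormedSpace ℝ E] {ρ : E → ℝ} {p : E}
    (hρ : ContDiffAt ℝ 3 ρ p) :
    (fun z => ρ z - (ρ p + fderiv ℝ ρ p (z - p) +
      1 / 2 * fderiv ℝ (fderiv ℝ ρ) p (z - p) (z - p))) =O[nhds p] fun z => ‖z - p‖ ^ 3 := by
  have hρ1 : ContDiffAt ℝ 2 (fderiv ℝ ρ) p := hρ.fderiv_right (by norm_num)
  have hρ2 : ContDiffAt ℝ 1 (fderiv ℝ (fderiv ℝ ρ)) p := hρ1.fderiv_right (by norm_num)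
  have hsymm : IsSymmSndFDerivAt ℝ ρ p :=
    hρ.isSymmSndFDerivAt (by simp only [minSmoothness_of_isRCLikeNormedField]; norm_num)
  have ev : ∀ᶠ z in nhds p, DifferentiableAt ℝ ρ z :=
    (hρ.eventually (by norm_num)).mono fun z hz => hz.differentiableAt (by norm_num)
  have ev1 : ∀ᶠ z in nhds p, DifferentiableAt ℝ (fderiv ℝ ρ) z :=
    (hρ1.eventually (by norm_num)).mono fun z hz => hz.differentiableAt (by norm_num)
  set D := fderiv ℝ ρ p
  set H := fderiv ℝ (fderiv ℝ ρ) p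
  have hid (z : E) : HasFDerivAt (fun z : E => z - p) (ContinuousLinearMap.id ℝ E) z :=
    (hasFDerivAt_id z).sub_const p
  have hlin (z : E) : HasFDerivAt (fun z : E => H (z - p)) H z :=
    (H.hasFDerivAt.comp z (hid z)).congr_fderiv H.comp_id
  have hh (z : E) (hz : DifferentiableAt ℝ ρ z) :
      HasFDerivAt (fun z => ρ z - (ρ p + D (z - p) + 1 / 2 * H (z - p) (z - p)))
        (fderiv ℝ ρ z - D - H (z - p)) z := by
    have h1 : HasFDerivAt (fun z => D (z - p)) D z :=
      (D.hasFDerivAt.comp z (hid z)).congr_fderiv D.comp_id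
    have h2 := ((hlin z).clm_apply (hid z)).const_mul (1 / 2)
    refine (hz.hasFDerivAt.sub ((h1.const_add (ρ p)).add h2)).congr_fderiv ?_
    ext v
    have hs : H v (z - p) = H (z - p) v := hsymm v (z - p)
    simp [-map_sub, hs]
    ring
  have hk (z : E) (hz : DifferentiableAt ℝ (fderiv ℝ ρ) z) :
      HasFDerivAt (fun z => fderiv ℝ ρ z - D - H (z - p)) (fderiv ℝ (fderiv ℝ ρ) z - H) z :=
    (hz.hasFDerivAt.sub_const D).sub (hlin z)
  have o1 : fderiv ℝ (fun z => fderiv ℝ ρ z - D - H (z - p)) =O[nhds p]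
      fun z => ‖z - p‖ ^ 1 := by
    have := (hρ2.differentiableAt (by norm_num)).isBigO_sub
    refine IsBigO.congr' this.norm_right (ev1.mono fun z hz => (hk z hz).fderiv.symm) ?_
    exact Filter.Eventually.of_forall fun z => (pow_one _).symm
  have o2 := isBigO_sub_of_fderiv_isBigO (ev1.mono fun z hz => (hk z hz).differentiableAt) o1
  have o3 : fderiv ℝ (fun z => ρ z - (ρ p + D (z - p) + 1 / 2 * H (z - p) (z - p))) =O[nhds p]
      fun z => ‖z - p‖ ^ 2 := by
    refine o2.congr' (ev.mono fun z hz => ?_) Filter.EventuallyEq.rfl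
    rw [(hh z hz).fderiv]
    simp [D]
  have o4 := isBigO_sub_of_fderiv_isBigO (ev.mono fun z hz => (hh z hz).differentiableAt) o3
  refine o4.congr_left fun z => ?_
  simp

/-- A complex frame for `J` in which the defining covector is `-2 Re (·)ₙ` and a positive Levi form
is the standard Hermitian form on the complex tangent space. -/
theorem exists_frame_of_levi_pos {n : ℕ} (J : (Fin (n + 1) → ℂ) →L[ℝ] (Fin (n + 1) → ℂ))
    (L : (Fin (n + 1) → ℂ) →L[ℝ] (Fin (n + 1) → ℂ) →L[ℝ] (Fin (n + 1) → ℂ))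
    (d : (Fin (n + 1) → ℂ) →L[ℝ] ℝ)
    (H : (Fin (n + 1) → ℂ) →L[ℝ] (Fin (n + 1) → ℂ) →L[ℝ] ℝ)
    (hJ : ∀ v, J (J v) = -v) (hd : d ≠ 0) (hH : ∀ u v, H u v = H v u)
    (hpos : ∀ v, v ≠ 0 → d v = 0 → d (J v) = 0 →
      0 < H v v + H (J v) (J v) - d (L v (J v) - L (J v) v)) :
    ∃ T : (Fin (n + 1) → ℂ) ≃L[ℝ] (Fin (n + 1) → ℂ), (∀ v, T (J v) = I • T v) ∧
      (∀ v, d v = -2 * (T v (Fin.last n)).re) ∧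
      ∀ v, T v (Fin.last n) = 0 → H v v + H (J v) (J v) - d (L v (J v) - L (J v) v) =
        4 * ∑ α : Fin n, normSq (T v α.castSucc) := by
  let a (v : Fin (n + 1) → ℂ) : ℝ := -(1 / 2) * d v
  let b (v : Fin (n + 1) → ℂ) : ℝ := 1 / 2 * d (J v)
  have aadd (u v) : a (u + v) = a u + a v := by simp only [a, map_add]; ring
  have badd (u v) : b (u + v) = b u + b v := by simp only [b, map_add]; ring
  have asmul (r : ℝ) (v) : a (r • v) = r * a v := by
    simp only [a, map_smul, smul_eq_mul]; ring
  have bsmul (r : ℝ) (v) : b (r • v) = r * b v := by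
    simp only [b, map_smul, smul_eq_mul]; ring
  have aJ (v) : a (J v) = -b v := by simp only [a, b]; ring
  have bJ (v) : b (J v) = a v := by simp only [a, b, hJ, map_neg]; ring
  obtain ⟨e, ae, be⟩ : ∃ e, a e = 1 ∧ b e = 0 := by
    obtain ⟨u, hu⟩ : ∃ u, d u ≠ 0 := by
      by_contra! h
      exact hd (ContinuousLinearMap.ext h)
    have hN : a u ^ 2 + b u ^ 2 ≠ 0 := by
      have : a u ≠ 0 := mul_ne_zero (by norm_num) hu
      positivity
    refine ⟨(a u / (a u ^ 2 + b u ^ 2)) • u + (-b u / (a u ^ 2 + b u ^ 2)) • J u, ?_, ?_⟩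
    · rw [aadd, asmul, asmul, aJ]
      field_simp
    · rw [badd, bsmul, bsmul, bJ]
      field_simp
      simp
  let π (v : Fin (n + 1) → ℂ) : Fin (n + 1) → ℂ := v - (a v • e + b v • J e)
  have πadd (u v) : π (u + v) = π u + π v := by simp only [π, aadd, badd]; module
  have πsmul (r : ℝ) (v) : π (r • v) = r • π v := by simp only [π, asmul, bsmul]; module
  have πJ (v) : π (J v) = J (π v) := by
    simp only [π, aJ, bJ, map_sub, map_add, map_smul, hJ]
    module
  have πe : π e = 0 := by simp [π, ae, be]
  have dπ (v) : d (π v) = 0 := by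
    have h : a (π v) = 0 := by
      simp only [π, sub_eq_add_neg, ← neg_one_smul ℝ (_ + _), aadd, asmul, aJ, ae, be]
      ring
    simpa [a] using h
  have dJπ (v) : d (J (π v)) = 0 := by rw [← πJ, dπ]
  let P (u v : Fin (n + 1) → ℂ) : ℝ := H u v + H (J u) (J v) -
    1 / 2 * (d (L u (J v) - L (J u) v) + d (L v (J u) - L (J v) u))
  have Padd (u u' v) : P (u + u') v = P u v + P u' v := by
    simp only [P, map_add, map_sub, add_apply]
    ring
  have Psmul (r : ℝ) (u v) : P (r • u) v = r * P u v := by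
    simp only [P, map_smul, map_sub, smul_apply, smul_eq_mul]
    ring
  have Psymm (u v) : P u v = P v u := by
    simp only [P, hH u v, hH (J u) (J v)]
    ring
  have PJ (u v) : P (J u) (J v) = P u v := by
    simp only [P, hJ, map_neg, neg_apply, map_sub]
    ring
  have P0 (v) : P 0 v = 0 := by simpa using Psmul 0 0 v
  have Pdiag (v) : P v v = H v v + H (J v) (J v) - d (L v (J v) - L (J v) v) := by
    simp only [P]
    ring
  let g : (Fin (n + 1) → ℂ) →ₗ[ℝ] (Fin (n + 1) → ℂ) →ₗ[ℝ] ℝ :=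
    LinearMap.mk₂ ℝ (fun u v => P (π u) (π v) / 4 + (a u * a v + b u * b v))
      (fun u u' v => by simp only [πadd, Padd, aadd, badd]; ring)
      (fun r u v => by simp only [πsmul, Psmul, asmul, bsmul, smul_eq_mul]; ring)
      (fun u v v' => by simp only [πadd, Psymm (π u), Padd, aadd, badd]; ring)
      (fun r u v => by simp only [πsmul, Psymm (π u), Psmul, asmul, bsmul, smul_eq_mul]; ring)
  have g_def (u v) : g u v = P (π u) (π v) / 4 + (a u * a v + b u * b v) := rfl
  have hdim : Module.finrank ℝ (Fin (n + 1) → ℂ) = 2 * (n + 1) := by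
    rw [Module.finrank_pi_fintype]
    simp [Complex.finrank_real_complex, mul_comm]
  obtain ⟨T, hTJ, hTg, hTe⟩ := exists_linearEquiv_of_invariant_form n hdim (J : _ →ₗ[ℝ] _) hJ g
    (fun u v => by rw [g_def, g_def, Psymm]; ring)
    (fun u v => by
      simp only [g_def, ContinuousLinearMap.coe_coe, πJ, PJ, aJ, bJ]
      ring)
    (fun v hv => by
      rw [g_def]
      by_cases h : π v = 0
      · rw [h, P0]
        have hab : a v ≠ 0 ∨ b v ≠ 0 := by
          by_contra! hab
          apply hv
          simpa [π, hab.1, hab.2] using h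
        rcases hab with h | h
        · linarith [mul_self_pos.2 h, mul_self_nonneg (b v)]
        · linarith [mul_self_pos.2 h, mul_self_nonneg (a v)]
      · have := hpos (π v) h (dπ v) (dJπ v)
        rw [← Pdiag] at this
        linarith [mul_self_nonneg (a v), mul_self_nonneg (b v)])
    e (by rw [g_def, πe, P0, ae, be]; norm_num)
  have hlast (v) : T v (Fin.last n) = (a v : ℂ) + (b v : ℂ) * I := by
    rw [hTe, g_def, g_def, ContinuousLinearMap.coe_coe, πJ, πe, map_zero, P0, aJ, bJ, ae, be]
    simp
  refine ⟨T.toContinuousLinearEquiv, hTJ, fun v => ?_, fun v hv => ?_⟩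
  · have : T v (Fin.last n) = _ := hlast v
    simp [this, a]
  · change T v (Fin.last n) = 0 at hv
    have h := hlast v
    rw [hv] at h
    have ha : a v = 0 := by simpa using (congrArg Complex.re h).symm
    have hb : b v = 0 := by simpa using (congrArg Complex.im h).symm
    have hπ : π v = v := by simp [π, ha, hb]
    have hg := hTg v
    rw [g_def, hπ, ha, hb, Fin.sum_univ_castSucc, hv, map_zero, Pdiag] at hg
    simp only [LinearEquiv.coe_toContinuousLinearEquiv']
    linarith

/-- A smooth map with invertible derivative restricts to a diffeomorphism of small neighborhoods. -/
theorem exists_bijOn_contDiffOn_invFunOn {E : Type*} [NormedAddCommGroup E] [NormedSpace ℝ E]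
    [CompleteSpace E] {Φ : E → E} (hΦ : ContDiff ℝ (⊤ : ℕ∞) Φ) {p : E} {T : E ≃L[ℝ] E}
    (hT : HasFDerivAt Φ (T : E →L[ℝ] E) p) {U : Set E} (hU : IsOpen U) (hp : p ∈ U) :
    ∃ V W : Set E, IsOpen V ∧ IsOpen W ∧ p ∈ V ∧ V ⊆ U ∧ Set.BijOn Φ V W ∧
      ContDiffOn ℝ (⊤ : ℕ∞) (Function.invFunOn Φ V) W := by
  have htop : ((⊤ : ℕ∞) : WithTop ℕ∞) ≠ 0 := by simp
  let Ψ := hΦ.contDiffAt.toOpenPartialHomeomorph Φ hT htop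
  let O : Set E := {z | fderiv ℝ Φ z ∈ Set.range ((↑) : (E ≃L[ℝ] E) → E →L[ℝ] E)}
  have hO : IsOpen O := ContinuousLinearEquiv.isOpen.preimage (hΦ.continuous_fderiv htop)
  have hpΨ : p ∈ Ψ.source := hΦ.contDiffAt.mem_toOpenPartialHomeomorph_source hT htop
  let V := Ψ.source ∩ (U ∩ O)
  have hV : IsOpen V := Ψ.open_source.inter (hU.inter hO)
  have hinj : Set.InjOn Φ V := Ψ.injOn.mono Set.inter_subset_left
  refine ⟨V, Φ '' V, hV, Ψ.isOpen_image_of_subset_source hV Set.inter_subset_left,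
    ⟨hpΨ, hp, T, hT.fderiv.symm⟩, fun z hz => hz.2.1, hinj.bijOn_image, ?_⟩
  have hsymm : ∀ z ∈ V, Ψ.symm (Φ z) = z := fun z hz => Ψ.left_inv hz.1
  have hs : ContDiffOn ℝ (⊤ : ℕ∞) Ψ.symm (Φ '' V) := by
    rintro _ ⟨z, hz, rfl⟩
    obtain ⟨A, hA⟩ := hz.2.2
    refine (Ψ.contDiffAt_symm (f₀' := A) (Ψ.map_source hz.1) ?_ hΦ.contDiffAt).contDiffWithinAt
    rw [hA, Ψ.left_inv hz.1]
    exact (hΦ.differentiable htop z).hasFDerivAt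
  refine hs.congr ?_
  rintro _ ⟨z, hz, rfl⟩
  rw [hinj.leftInvOn_invFunOn hz, hsymm z hz]

/-- First-order expansion of the push-forward of an endomorphism field by a diffeomorphism. -/
theorem fderiv_pushforward {E : Type*} [NormedAddCommGroup E] [NormedSpace ℝ E]
    [CompleteSpace E] {Φ g : E → E} {J Jt : E → E →L[ℝ] E} {p : E} {T : E ≃L[ℝ] E}
    (hΦ : DifferentiableAt ℝ Φ p) (hΦ' : DifferentiableAt ℝ (fderiv ℝ Φ) p)
    (hT : fderiv ℝ Φ p = T) (hJ : DifferentiableAt ℝ J p)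
    (hg : DifferentiableAt ℝ g (Φ p)) (hgΦ : ∀ᶠ z in nhds p, g (Φ z) = z)
    (hJt : ∀ w, Jt w = (fderiv ℝ Φ (g w)).comp ((J (g w)).comp (fderiv ℝ Φ (g w)).inverse)) :
    (∀ v, Jt (Φ p) (T v) = T (J p v)) ∧
      ∀ u v, fderiv ℝ Jt (Φ p) (T u) (T v) + Jt (Φ p) (fderiv ℝ (fderiv ℝ Φ) p u v) =
        fderiv ℝ (fderiv ℝ Φ) p u (J p v) + T (fderiv ℝ J p u v) := by
  have hgp : g (Φ p) = p := hgΦ.self_of_nhds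
  have hinv : ∀ᶠ z in nhds p, ∃ A : E ≃L[ℝ] E, (A : E →L[ℝ] E) = fderiv ℝ Φ z :=
    hΦ'.continuousAt (by rw [hT]; exact T.nhds)
  have hcomm : ∀ᶠ z in nhds p,
      (Jt (Φ z)).comp (fderiv ℝ Φ z) = (fderiv ℝ Φ z).comp (J z) := by
    filter_upwards [hgΦ, hinv] with z hz ⟨A, hA⟩
    rw [hJt, hz, ← hA, ContinuousLinearMap.inverse_equiv]
    ext v
    simp
  have hdJt : DifferentiableAt ℝ Jt (Φ p) := by
    rw [show Jt = fun w => _ from funext hJt]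
    have h1 : DifferentiableAt ℝ (fun w => fderiv ℝ Φ (g w)) (Φ p) :=
      DifferentiableAt.comp (Φ p) (by rwa [hgp]) hg
    have h2 : DifferentiableAt ℝ (fun w => J (g w)) (Φ p) :=
      DifferentiableAt.comp (Φ p) (by rwa [hgp]) hg
    have h3 : DifferentiableAt ℝ (fun w => (fderiv ℝ Φ (g w)).inverse) (Φ p) := by
      refine DifferentiableAt.comp (Φ p) (g := ContinuousLinearMap.inverse) ?_ h1
      rw [hgp, hT]
      exact (contDiffAt_map_inverse (n := 1) T).differentiableAt one_ne_zero
    exact h1.clm_comp (h2.clm_comp h3)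
  constructor
  · intro v
    have := congrArg (fun A : E →L[ℝ] E => A v) hcomm.self_of_nhds
    simpa [hT] using this
  · intro u v
    have h1 := (hdJt.hasFDerivAt.comp p hΦ.hasFDerivAt).clm_comp hΦ'.hasFDerivAt
    have h2 := hΦ'.hasFDerivAt.clm_comp hJ.hasFDerivAt
    have h3 := h1.unique (h2.congr_of_eventuallyEq hcomm)
    have h4 := congrArg (fun A : E →L[ℝ] E →L[ℝ] E => A u v) h3
    simp [hT] at h4
    rw [add_comm, h4, add_comm]

/-- Coefficients of a conjugate-bilinear antisymmetric map. -/
theorem exists_coeff_of_conj_bilinear {m : ℕ}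
    (K : (Fin m → ℂ) →L[ℝ] (Fin m → ℂ) →L[ℝ] (Fin m → ℂ))
    (hK : ∀ y x, K (I • y) x = -(I • K y x)) (hanti : ∀ y x, K y x = -K x y) :
    ∃ L : Fin m → Fin m → Fin m → ℂ,
      (∀ z v i, K z v i = ∑ j, ∑ k, (L i j k * conj (z k)) * conj (v j)) ∧
      ∀ i j k, L i j k = -L i k j := by
  have hsmul (c : ℂ) (y x) : K (c • y) x = conj c • K y x := by
    have hc : c • y = c.re • y + c.im • I • y := by
      ext i
      simp only [Pi.smul_apply, Pi.add_apply, smul_eq_mul, real_smul]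
      nth_rewrite 1 [← re_add_im c]
      ring
    rw [hc]
    simp only [map_add, map_smul, add_apply, smul_apply, hK]
    ext i
    apply Complex.ext <;> simp
  have hsmul' (c : ℂ) (y x) : K y (c • x) = conj c • K y x := by
    rw [hanti, hsmul, hanti y x, smul_neg]
  refine ⟨fun i j k => K (Pi.single k 1) (Pi.single j 1) i, fun z v i => ?_, fun i j k => ?_⟩
  · have hsum (y : Fin m → ℂ) : y = ∑ k, y k • (Pi.single k 1 : Fin m → ℂ) := by
      simpa using pi_eq_sum_univ' y
    conv_lhs => rw [hsum z, hsum v]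
    simp only [map_sum, hsmul', hsmul, Finset.sum_apply, _root_.sum_apply,
      Pi.smul_apply, smul_eq_mul]
    refine Finset.sum_congr rfl fun j _ => Finset.sum_congr rfl fun k _ => ?_
    ring
  · exact congrFun (hanti _ _) i

/-- The second-degree polynomial map with linear part `T` and quadratic part `S` at `p`. -/
def quadraticChart {E : Type*} [NormedAddCommGroup E] [NormedSpace ℝ E] (p : E) (T : E ≃L[ℝ] E)
    (S : E →L[ℝ] E →L[ℝ] E) (z : E) : E :=
  T (z - p) + (1 / 2 : ℝ) • S (T (z - p)) (T (z - p))

theorem contDiff_quadraticChart {E : Type*} [NormedAddCommGroup E] [NormedSpace ℝ E] (p : E)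
    (T : E ≃L[ℝ] E) (S : E →L[ℝ] E →L[ℝ] E) : ContDiff ℝ (⊤ : ℕ∞) (quadraticChart p T S) := by
  unfold quadraticChart
  have h : ContDiff ℝ (⊤ : ℕ∞) fun z : E => T (z - p) :=
    T.contDiff.comp (contDiff_id.sub contDiff_const)
  exact h.add (contDiff_const.smul ((S.contDiff.comp h).clm_apply h))

theorem hasFDerivAt_quadraticChart {E : Type*} [NormedAddCommGroup E] [NormedSpace ℝ E] (p : E)
    (T : E ≃L[ℝ] E) (S : E →L[ℝ] E →L[ℝ] E) (hS : ∀ y x, S y x = S x y) (z : E) :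
    HasFDerivAt (quadraticChart p T S)
      ((T : E →L[ℝ] E) + (S (T (z - p))).comp (T : E →L[ℝ] E)) z := by
  have hT : HasFDerivAt (fun z : E => T (z - p)) (T : E →L[ℝ] E) z :=
    (T.hasFDerivAt.comp z ((hasFDerivAt_id z).sub_const p)).congr_fderiv
      (ContinuousLinearMap.comp_id _)
  have hST := ((S.hasFDerivAt.comp z hT).clm_apply hT).const_smul (1 / 2 : ℝ)
  refine (hT.add hST).congr_fderiv ?_
  ext v
  have h := hS (T v) (T (z - p))
  simp [-map_sub, h, ← two_smul ℝ]

theorem hasFDerivAt_fderiv_quadraticChart {E : Type*} [NormedAddCommGroup E] [NormedSpace ℝ E]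
    (p : E) (T : E ≃L[ℝ] E) (S : E →L[ℝ] E →L[ℝ] E) (hS : ∀ y x, S y x = S x y) :
    ∃ B : E →L[ℝ] E →L[ℝ] E, HasFDerivAt (fderiv ℝ (quadraticChart p T S)) B p ∧
      ∀ u v, B u v = S (T u) (T v) := by
  rw [show fderiv ℝ (quadraticChart p T S) = _ from
    funext fun z => (hasFDerivAt_quadraticChart p T S hS z).fderiv]
  have hT : HasFDerivAt (fun z : E => T (z - p)) (T : E →L[ℝ] E) p :=
    (T.hasFDerivAt.comp p ((hasFDerivAt_id p).sub_const p)).congr_fderiv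
      (ContinuousLinearMap.comp_id _)
  refine ⟨_, ((S.hasFDerivAt.comp p hT).clm_comp (hasFDerivAt_const _ p)).const_add _,
    fun u v => ?_⟩
  simp

/-- Third-order estimate for the defining function in a quadratic chart whose quadratic part
matches the Hessian. -/
theorem quadraticChart_isBigO {n : ℕ} {ρ : (Fin (n + 1) → ℂ) → ℝ} {p : Fin (n + 1) → ℂ}
    (hρ : ContDiffAt ℝ 3 ρ p) (hρp : ρ p = 0) (T : (Fin (n + 1) → ℂ) ≃L[ℝ] (Fin (n + 1) → ℂ))
    (S : (Fin (n + 1) → ℂ) →L[ℝ] (Fin (n + 1) → ℂ) →L[ℝ] (Fin (n + 1) → ℂ))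
    (μ : (Fin (n + 1) → ℂ) →L[ℝ] ℝ)
    (hd : ∀ v, fderiv ℝ ρ p v = -2 * (T v (Fin.last n)).re)
    (hS : ∀ v, (S (T v) (T v) (Fin.last n)).re = ∑ α : Fin n, normSq (T v α.castSucc) -
      1 / 2 * fderiv ℝ (fderiv ℝ ρ) p v v + 2 * μ (T v) * (T v (Fin.last n)).re) :
    (fun z => -(1 + μ (quadraticChart p T S z)) * ρ z -
      (2 * (quadraticChart p T S z (Fin.last n)).re -
        ∑ α : Fin n, normSq (quadraticChart p T S z α.castSucc)))
      =O[nhds p] fun z => ‖z - p‖ ^ 3 := by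
  set Φ := quadraticChart p T S
  set H := fderiv ℝ (fderiv ℝ ρ) p
  have hΦp : Φ p = 0 := by simp [Φ, quadraticChart]
  have hN : (fun z : Fin (n + 1) → ℂ => z - p) =O[nhds p] fun z => ‖z - p‖ :=
    (isBigO_refl _ _).norm_right
  have hcoord (f : (Fin (n + 1) → ℂ) → (Fin (n + 1) → ℂ)) (k : ℕ)
      (hf : f =O[nhds p] fun z => ‖z - p‖ ^ k) (i : Fin (n + 1)) :
      (fun z => f z i) =O[nhds p] fun z => ‖z - p‖ ^ k :=
    (IsBigO.of_norm_le fun z => norm_le_pi_norm (f z) i).trans hf.norm_left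
  have hre (f : (Fin (n + 1) → ℂ) → ℂ) (k : ℕ)
      (hf : f =O[nhds p] fun z => ‖z - p‖ ^ k) :
      (fun z => (f z).re) =O[nhds p] fun z => ‖z - p‖ ^ k :=
    (IsBigO.of_norm_le fun z => abs_re_le_norm (f z)).trans hf.norm_left
  have hΦO : Φ =O[nhds p] fun z => ‖z - p‖ ^ 1 := by
    have h := ((contDiff_quadraticChart p T S).differentiable (by simp) p).isBigO_sub
    simpa [Φ, hΦp, show quadraticChart p T S p = 0 from hΦp] using h.norm_right
  have hμO : (fun z => μ (Φ z)) =O[nhds p] fun z => ‖z - p‖ ^ 1 :=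
    (μ.isBigO_comp Φ _).trans hΦO
  have hyO : (fun z => T (z - p)) =O[nhds p] fun z => ‖z - p‖ ^ 1 := by
    simp only [pow_one]
    exact
      ((T : (Fin (n + 1) → ℂ) →L[ℝ] (Fin (n + 1) → ℂ)).isBigO_comp (fun z => z - p) _).trans hN
  have hsO : (fun z => (1 / 2 : ℝ) • S (T (z - p)) (T (z - p))) =O[nhds p]
      fun z => ‖z - p‖ ^ 2 := by
    suffices h : (fun z => S (T (z - p)) (T (z - p))) =O[nhds p] fun z => ‖z - p‖ ^ 2 from
      h.const_smul_left (1 / 2 : ℝ)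
    refine (IsBigO.of_bound ‖S‖ (Filter.Eventually.of_forall fun z => ?_)).trans (hyO.norm_left.mul
      hyO.norm_left |>.congr_right fun z => by ring)
    simpa [-map_sub, mul_assoc] using S.le_opNorm₂ (T (z - p)) (T (z - p))
  have hHO : (fun z => H (z - p) (z - p)) =O[nhds p] fun z => ‖z - p‖ ^ 2 := by
    refine IsBigO.of_bound ‖H‖ (Filter.Eventually.of_forall fun z => ?_)
    simpa [-map_sub, mul_assoc, sq] using H.le_opNorm₂ (z - p) (z - p)
  have hμ1 : (fun z => 1 + μ (Φ z)) =O[nhds p] fun _ => (1 : ℝ) := by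
    have hc : ContinuousAt (fun z => 1 + μ (Φ z)) p :=
      (continuous_const.add
        (μ.continuous.comp (contDiff_quadraticChart p T S).continuous)).continuousAt
    exact hc.isBigO_one ℝ
  have e1 : (fun z => μ (Φ z) * (1 / 2 * H (z - p) (z - p))) =O[nhds p] fun z => ‖z - p‖ ^ 3 :=
    (hμO.mul (hHO.const_mul_left (1 / 2))).congr_right fun z => by ring
  have e2 : (fun z => 2 * μ ((1 / 2 : ℝ) • S (T (z - p)) (T (z - p))) *
      (T (z - p) (Fin.last n)).re) =O[nhds p] fun z => ‖z - p‖ ^ 3 :=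
    ((((μ.isBigO_comp _ _).trans hsO).const_mul_left 2).mul
      (hre _ _ (hcoord _ _ hyO _))).congr_right fun z => by ring
  have e3 : (fun z => (1 + μ (Φ z)) * (ρ z - (ρ p + fderiv ℝ ρ p (z - p) +
      1 / 2 * H (z - p) (z - p)))) =O[nhds p] fun z => ‖z - p‖ ^ 3 :=
    (hμ1.mul (taylor_two_isBigO hρ)).congr_right fun z => by ring
  have e4 : (fun z => ∑ α : Fin n, (((1 / 2 : ℝ) • S (T (z - p)) (T (z - p))) α.castSucc *
      conj (Φ z α.castSucc + T (z - p) α.castSucc)).re) =O[nhds p] fun z => ‖z - p‖ ^ 3 := by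
    refine IsBigO.fun_sum fun α _ => hre _ _ ?_
    have h := ((hcoord _ _ hΦO α.castSucc).add (hcoord _ _ hyO α.castSucc)).norm_left
    have h' : (fun z => conj (Φ z α.castSucc + T (z - p) α.castSucc)) =O[nhds p]
        fun z => ‖z - p‖ ^ 1 :=
      IsBigO.of_norm_left (h.congr_left fun z => (RCLike.norm_conj _).symm)
    exact ((hcoord _ _ hsO α.castSucc).mul h').congr_right fun z => by ring
  refine (((e2.sub e1).sub e3).add e4).congr_left fun z => ?_
  have hsum : ∑ α : Fin n, (((1 / 2 : ℝ) • S (T (z - p)) (T (z - p))) α.castSucc *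
      conj (Φ z α.castSucc + T (z - p) α.castSucc)).re =
      ∑ α : Fin n, normSq (Φ z α.castSucc) - ∑ α : Fin n, normSq (T (z - p) α.castSucc) := by
    rw [← Finset.sum_sub_distrib]
    refine Finset.sum_congr rfl fun α _ => ?_
    have : Φ z α.castSucc = T (z - p) α.castSucc +
      ((1 / 2 : ℝ) • S (T (z - p)) (T (z - p))) α.castSucc := rfl
    rw [this]
    generalize ((1 / 2 : ℝ) • S (T (z - p)) (T (z - p))) α.castSucc = s
    generalize T (z - p) α.castSucc = y
    simp [normSq_apply]
    ring
  have hlast : (Φ z (Fin.last n)).re =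
      (T (z - p) (Fin.last n)).re + 1 / 2 * (S (T (z - p)) (T (z - p)) (Fin.last n)).re := by
    simp [-map_sub, Φ, quadraticChart]
  have hμΦ : μ (Φ z) = μ (T (z - p)) + μ ((1 / 2 : ℝ) • S (T (z - p)) (T (z - p))) := by
    rw [← map_add]
    rfl
  rw [hsum, hlast, hS, hd, hρp, hμΦ]
  ring

/-- A quadratic part that antisymmetrizes the conjugate-linear part of `L` and at the same time
normalizes the Hessian form `H`. -/
theorem exists_symm_bilinear_normalizing {n : ℕ}
    (L : (Fin (n + 1) → ℂ) →L[ℝ] (Fin (n + 1) → ℂ) →L[ℝ] (Fin (n + 1) → ℂ))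
    (hL : ∀ y x, L y (I • x) = -(I • L y x))
    (H : (Fin (n + 1) → ℂ) →L[ℝ] (Fin (n + 1) → ℂ) →L[ℝ] ℝ) (hH : ∀ y x, H y x = H x y)
    (hlevi : ∀ y : Fin (n + 1) → ℂ, y (Fin.last n) = 0 →
      H y y + H (I • y) (I • y) + 2 * ((L y (I • y) - L (I • y) y) (Fin.last n)).re =
        4 * ∑ α : Fin n, normSq (y α.castSucc)) :
    ∃ (S : (Fin (n + 1) → ℂ) →L[ℝ] (Fin (n + 1) → ℂ) →L[ℝ] (Fin (n + 1) → ℂ))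
      (μ : (Fin (n + 1) → ℂ) →L[ℝ] ℝ),
      (∀ y x, S y x = S x y) ∧
      (∀ y x, S (I • y) (I • x) - I • S (I • y) x + L (I • y) x =
        -(I • (S y (I • x) - I • S y x + L y x))) ∧
      (∀ y x, S y (I • x) - I • S y x + L y x = -(S x (I • y) - I • S x y + L x y)) ∧
      ∀ y, (S y y (Fin.last n)).re = ∑ α : Fin n, normSq (y α.castSucc) - 1 / 2 * H y y +
        2 * μ y * (y (Fin.last n)).re := by
  obtain ⟨S, hS, hSL, hSL', hSq⟩ := exists_symm_bilinear_antisymmetrize L hL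
  let r : (Fin (n + 1) → ℂ) →L[ℝ] ℝ :=
    reCLM.comp (ContinuousLinearMap.proj (R := ℝ) (φ := fun _ => ℂ) (Fin.last n))
  obtain ⟨μ, c, hc, hcI, hcq⟩ := exists_holomorphic_quadratic
    ((1 / 2 : ℝ) • H + (ContinuousLinearMap.compL ℝ _ _ _ r).comp S)
    (fun y x => by simp [hH y x, hS y x]) fun y hy => by
      have h := hlevi y hy
      rw [← hSq y] at h
      simp only [Pi.add_apply, add_re] at h
      simp only [add_apply, smul_apply, ContinuousLinearMap.comp_apply, smul_eq_mul,
        ContinuousLinearMap.compL_apply, r, reCLM_apply, ContinuousLinearMap.proj_apply]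
      linarith
  let s : ℂ →L[ℝ] (Fin (n + 1) → ℂ) :=
    ContinuousLinearMap.single ℝ (fun _ => ℂ) (Fin.last n)
  have hsI (z : ℂ) : s (I * z) = I • s z := by
    simp only [s, ContinuousLinearMap.single_apply]
    rw [← smul_eq_mul, Pi.single_smul]
  have hS' (y x) : (S + (ContinuousLinearMap.compL ℝ _ _ _ s).comp c) y x = S y x + s (c y x) := rfl
  have hK (y x) : S y (I • x) + s (c y (I • x)) - I • (S y x + s (c y x)) =
      S y (I • x) - I • S y x := by
    rw [hcI, hsI]
    module
  refine ⟨S + (ContinuousLinearMap.compL ℝ _ _ _ s).comp c, μ, fun y x => ?_, fun y x => ?_,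
    fun y x => ?_, fun y => ?_⟩
  · rw [hS', hS', hS y x, hc y x]
  · simp only [hS', hK, hSL]
  · simp only [hS', hK]
    exact hSL' y x
  · have h := hcq y
    simp only [add_apply, smul_apply, ContinuousLinearMap.comp_apply, smul_eq_mul,
        ContinuousLinearMap.compL_apply, r, reCLM_apply, ContinuousLinearMap.proj_apply] at h
    rw [hS', Pi.add_apply, add_re]
    simp only [s, ContinuousLinearMap.single_apply, Pi.single_eq_same, h]
    ring

/-- The exterior derivative of `dρ ∘ J` in terms of the Hessian of `ρ` and the derivative of `J`. -/
theorem dtheta_eq {n : ℕ} {ρ : (Fin n → ℂ) → ℝ}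
    {J : (Fin n → ℂ) → ((Fin n → ℂ) →L[ℝ] (Fin n → ℂ))} {z : Fin n → ℂ}
    (hρ : DifferentiableAt ℝ (fderiv ℝ ρ) z) (hJ : DifferentiableAt ℝ J z) (u w : Fin n → ℂ) :
    dtheta n ρ J z u w =
      fderiv ℝ (fderiv ℝ ρ) z u (J z w) - fderiv ℝ (fderiv ℝ ρ) z w (J z u) +
        fderiv ℝ ρ z (fderiv ℝ J z u w - fderiv ℝ J z w u) := by
  have h : HasFDerivAt (theta n ρ J) _ z := hρ.hasFDerivAt.clm_comp hJ.hasFDerivAt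
  simp only [dtheta, h.fderiv, add_apply, ContinuousLinearMap.comp_apply,
    ContinuousLinearMap.compL_apply, ContinuousLinearMap.flip_apply, map_sub]
  ring

/-- Differentiating `J ∘ J = -1`. -/
theorem fderiv_apply_complexStructure {E : Type*} [NormedAddCommGroup E] [NormedSpace ℝ E]
    {J : E → E →L[ℝ] E} {p : E} (hJ : DifferentiableAt ℝ J p)
    (hJJ : ∀ᶠ z in nhds p, ∀ v, J z (J z v) = -v) (u v : E) :
    fderiv ℝ J p u (J p v) = -J p (fderiv ℝ J p u v) := by
  have h := hJ.hasFDerivAt.clm_comp hJ.hasFDerivAt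
  have h0 : (fun z => (J z).comp (J z)) =ᶠ[nhds p] fun _ => -ContinuousLinearMap.id ℝ E :=
    hJJ.mono fun z hz => ContinuousLinearMap.ext hz
  have h1 := congrArg (fun A : E →L[ℝ] E →L[ℝ] E => A u v)
    (h.unique ((hasFDerivAt_const _ p).congr_of_eventuallyEq h0))
  simp only [add_apply, ContinuousLinearMap.comp_apply, ContinuousLinearMap.compL_apply,
    ContinuousLinearMap.flip_apply, zero_apply] at h1
  exact eq_neg_of_add_eq_zero_right h1

/-- a hypersurface `Γ = {ρ = 0}` that is strongly pseudoconvex at `p` with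
respect to an almost complex structure `J` can be put, together with `J`, in standard form
by a smooth local diffeomorphism `Φ` with `Φ(p) = 0`.  (Ambient space `ℂ^{n+1}`, greek
indices in `Fin n` via `Fin.castSucc`, distinguished index `Fin.last n`.) -/
theorem stmt8 (n : ℕ) (hn : 1 ≤ n)
    (U : Set (Fin (n+1) → ℂ)) (hUopen : IsOpen U)
    (p : Fin (n+1) → ℂ) (hpU : p ∈ U)
    (J : (Fin (n+1) → ℂ) → ((Fin (n+1) → ℂ) →L[ℝ] (Fin (n+1) → ℂ)))
    (hJsmooth : ContDiffOn ℝ (⊤ : ℕ∞) J U)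
    (hJacs : ∀ z ∈ U, ∀ v, J z (J z v) = -v)
    (ρ : (Fin (n+1) → ℂ) → ℝ) (hρ : ContDiffOn ℝ (⊤ : ℕ∞) ρ U)
    (hρp : ρ p = 0) (hdρp : fderiv ℝ ρ p ≠ 0)
    -- strong pseudoconvexity at p: the Levi form is positive definite on D_p
    (hspc : ∀ v : Fin (n+1) → ℂ, v ≠ 0 →
      fderiv ℝ ρ p v = 0 → fderiv ℝ ρ p (J p v) = 0 →
      0 < - dtheta (n+1) ρ J p v (J p v)) :
    ∃ (V W : Set (Fin (n+1) → ℂ)) (Φ : (Fin (n+1) → ℂ) → (Fin (n+1) → ℂ)),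
      IsOpen V ∧ IsOpen W ∧ p ∈ V ∧ V ⊆ U ∧ (0 : Fin (n+1) → ℂ) ∈ W ∧
      Φ p = 0 ∧ ContDiffOn ℝ (⊤ : ℕ∞) Φ V ∧ Set.BijOn Φ V W ∧
      ContDiffOn ℝ (⊤ : ℕ∞) (Function.invFunOn Φ V) W ∧
      -- the pushforward structure in the new coordinates
      (∀ Jt : (Fin (n+1) → ℂ) → ((Fin (n+1) → ℂ) →L[ℝ] (Fin (n+1) → ℂ)),
        (∀ w, Jt w =
          (fderiv ℝ Φ (Function.invFunOn Φ V w)).comp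
            ((J (Function.invFunOn Φ V w)).comp
              ((fderiv ℝ Φ (Function.invFunOn Φ V w)).inverse))) →
        -- J̃₀ = J_st
        Jt 0 = Jstd (n+1) ∧
        -- standard-form condition on the first-order coefficients of J̃
        (∃ L1 L2 : Fin (n+1) → Fin (n+1) → Fin (n+1) → ℂ,
          (∀ (z v : Fin (n+1) → ℂ) (i : Fin (n+1)),
            fderiv ℝ Jt 0 z v i =
              ∑ j, ∑ k, (L1 i j k * z k + L2 i j k * conj (z k)) * conj (v j)) ∧
          (∀ α β : Fin n, L1 (Fin.last n) α.castSucc β.castSucc = 0) ∧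
          (∀ α β : Fin n, L2 (Fin.last n) α.castSucc β.castSucc =
            - L2 (Fin.last n) β.castSucc α.castSucc))) ∧
      -- Φ(Γ ∩ V) has near 0 a defining function in normal form
      (∃ (W' : Set (Fin (n+1) → ℂ)) (ρt : (Fin (n+1) → ℂ) → ℝ),
        IsOpen W' ∧ (0 : Fin (n+1) → ℂ) ∈ W' ∧ ContDiffOn ℝ (⊤ : ℕ∞) ρt W' ∧
        (∀ w ∈ W', (ρt w = 0 ↔ w ∈ Φ '' {z ∈ V | ρ z = 0})) ∧
        (fun w : Fin (n+1) → ℂ =>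
            ρt w - (2 * (w (Fin.last n)).re -
              ∑ α : Fin n, Complex.normSq (w α.castSucc)))
          =O[nhds 0] fun w : Fin (n+1) → ℂ => ‖w‖ ^ 3) := by
  have hU := hUopen.mem_nhds hpU
  have hρC := hρ.contDiffAt hU
  have hJd : DifferentiableAt ℝ J p := (hJsmooth.contDiffAt hU).differentiableAt (by simp)
  have hρd : DifferentiableAt ℝ (fderiv ℝ ρ) p :=
    (hρC.fderiv_right (m := 1) (by norm_cast)).differentiableAt one_ne_zero
  have hJJ := hJacs p hpU
  have hH : ∀ u v, fderiv ℝ (fderiv ℝ ρ) p u v = fderiv ℝ (fderiv ℝ ρ) p v u :=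
    hρC.isSymmSndFDerivAt (by
      rw [minSmoothness_of_isRCLikeNormedField]
      norm_cast)
  have hLJ := fderiv_apply_complexStructure hJd (Filter.eventually_of_mem hU hJacs)
  obtain ⟨T, hTJ, hTd, hTlevi⟩ := exists_frame_of_levi_pos (J p) (fderiv ℝ J p) (fderiv ℝ ρ p)
    (fderiv ℝ (fderiv ℝ ρ) p) hJJ hdρp hH fun v hv hdv hdJv => by
      have h := hspc v hv hdv hdJv
      rw [dtheta_eq hρd hJd, hJJ, map_neg] at h
      linarith
  have hTI (y) : T.symm (I • y) = J p (T.symm y) := by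
    rw [T.symm_apply_eq, hTJ, T.apply_symm_apply]
  let T' : (Fin (n + 1) → ℂ) →L[ℝ] (Fin (n + 1) → ℂ) := T.symm
  obtain ⟨S, μ, hS, hSI, hSanti, hSre⟩ := exists_symm_bilinear_normalizing
    ((ContinuousLinearMap.compL ℝ _ _ _ (T : (Fin (n + 1) → ℂ) →L[ℝ] (Fin (n + 1) → ℂ))).comp
      ((fderiv ℝ J p).bilinearComp T' T'))
    (fun y x => by simp [T', hTI, hLJ, hTJ])
    ((fderiv ℝ (fderiv ℝ ρ) p).bilinearComp T' T')
    (fun y x => hH _ _)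
    fun y hy => by
      have h := hTlevi (T.symm y) (by simpa using hy)
      rw [hTd, map_sub] at h
      simpa [T', hTI] using h
  simp only [ContinuousLinearMap.comp_apply, ContinuousLinearMap.compL_apply,
    ContinuousLinearMap.bilinearComp_apply, T', ContinuousLinearEquiv.coe_coe] at hSI hSanti hSre
  set Φ := quadraticChart p T S with hΦ
  have hΦp : Φ p = 0 := by simp [hΦ, quadraticChart]
  have hΦC : ContDiff ℝ (⊤ : ℕ∞) Φ := contDiff_quadraticChart p T S
  have hΦT : HasFDerivAt Φ (T : (Fin (n + 1) → ℂ) →L[ℝ] (Fin (n + 1) → ℂ)) p := by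
    simpa using hasFDerivAt_quadraticChart p T S hS p
  obtain ⟨B, hB, hBS⟩ := hasFDerivAt_fderiv_quadraticChart p T S hS
  obtain ⟨V, W, hV, hW, hpV, hVU, hbij, hgC⟩ := exists_bijOn_contDiffOn_invFunOn hΦC hΦT hUopen hpU
  set g := Function.invFunOn Φ V
  have hgΦ : ∀ z ∈ V, g (Φ z) = z := hbij.injOn.leftInvOn_invFunOn
  have hg : ∀ w ∈ W, g w ∈ V ∧ Φ (g w) = w := fun w hw =>
    ⟨Function.invFunOn_mem (hbij.surjOn hw), Function.invFunOn_eq (hbij.surjOn hw)⟩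
  have h0W : (0 : Fin (n + 1) → ℂ) ∈ W := hΦp ▸ hbij.mapsTo hpV
  have hg0 : g 0 = p := hΦp ▸ hgΦ p hpV
  have hgd : DifferentiableAt ℝ g 0 :=
    (hgC.contDiffAt (hW.mem_nhds h0W)).differentiableAt (by simp)
  refine ⟨V, W, Φ, hV, hW, hpV, hVU, h0W, hΦp, hΦC.contDiffOn, hbij, hgC, fun Jt hJt => ?_, ?_⟩
  · obtain ⟨hJ0, hK⟩ := fderiv_pushforward hΦT.differentiableAt hB.differentiableAt hΦT.fderiv hJd
      (hΦp.symm ▸ hgd) (Filter.eventually_of_mem (hV.mem_nhds hpV) hgΦ) hJt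
    rw [hΦp] at hJ0 hK
    have hJt0 : Jt 0 = Jstd (n + 1) := by
      ext1 v
      rw [← T.apply_symm_apply v, hJ0, hTJ]
      rfl
    have hK' (y x) : fderiv ℝ Jt 0 y x =
        S y (I • x) - I • S y x + T (fderiv ℝ J p (T.symm y) (T.symm x)) := by
      have h := hK (T.symm y) (T.symm x)
      rw [hB.fderiv, hBS, hBS, hJt0, hTJ, T.apply_symm_apply, T.apply_symm_apply] at h
      rw [sub_add_eq_add_sub, ← h]
      exact (add_sub_cancel_right _ _).symm
    obtain ⟨L, hL, hLanti⟩ := exists_coeff_of_conj_bilinear (fderiv ℝ Jt 0)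
      (fun y x => by simp only [hK', hSI]) (fun y x => by rw [hK', hK', hSanti])
    exact ⟨hJt0, 0, L, fun z v i => by simp [hL], fun _ _ => rfl, fun _ _ => hLanti _ _ _⟩
  · have hμ : Continuous fun w => 1 + μ w := continuous_const.add μ.continuous
    refine ⟨W ∩ {w | 1 + μ w ≠ 0}, fun w => -(1 + μ w) * ρ (g w),
      hW.inter (isOpen_ne_fun hμ continuous_const), ⟨h0W, by simp⟩, ?_, fun w hw => ?_, ?_⟩
    · have hρg : ContDiffOn ℝ (⊤ : ℕ∞) (fun w => ρ (g w)) W :=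
        hρ.comp hgC fun w hw => hVU (hg w hw).1
      exact ((contDiff_const.add μ.contDiff).neg.contDiffOn.mul hρg).mono Set.inter_subset_left
    · obtain ⟨hgV, hgw⟩ := hg w hw.1
      rw [mul_eq_zero, or_iff_right (neg_ne_zero.mpr hw.2)]
      refine ⟨fun h => ⟨g w, ⟨hgV, h⟩, hgw⟩, ?_⟩
      rintro ⟨z, ⟨hz, hρz⟩, rfl⟩
      rwa [hgΦ z hz]
    · have hO := (quadraticChart_isBigO (hρC.of_le (by norm_cast)) hρp T S μ hTd fun v => by
        simpa using hSre (T v)).comp_tendsto (hg0 ▸ hgd.continuousAt.tendsto)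
      have hgO : (fun w => ‖g w - p‖ ^ 3) =O[nhds 0] fun w => ‖w‖ ^ 3 := by
        have h := hgd.isBigO_sub
        simp only [hg0, sub_zero] at h
        exact h.norm_norm.pow 3
      refine (hO.trans hgO).congr' ?_ Filter.EventuallyEq.rfl
      filter_upwards [hW.mem_nhds h0W] with w hw
      change -(1 + μ (Φ (g w))) * ρ (g w) - (2 * (Φ (g w) (Fin.last n)).re -
        ∑ α : Fin n, normSq (Φ (g w) α.castSucc)) = _
      rw [(hg w hw).2]
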